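/- The Diophantine equation P₃(x) = P₄(y) has infinitely many solutions in positive integers, i.e., the set {(x, y) ∈ ℕ₊ × ℕ₊ : P₃(x) = P₄(y)} is infinite. -/

import Mathlib

/-- `partCount A n` is the number of partitions of `n` into parts from `A`. -/
def partCount (A : Finset ℕ) (n : ℕ) : ℕ :=
  ((Finset.univ : Finset (Nat.Partition n)).filter (fun p => ∀ i ∈ p.parts, i ∈ A)).card

/-- Partitions of `n` into parts from `insert m A` are partitions into parts from `A`
when `n < m`. -/
theorem partCount_insert_of_lt {A : Finset ℕ} {m n : ℕ} (h : n < m) :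
    partCount (insert m A) n = partCount A n := by
  unfold partCount
  congr 1
  ext p
  simp only [Finset.mem_filter, Finset.mem_univ, true_and, Finset.mem_insert]
  refine forall₂_congr fun i hi => or_iff_right ?_
  have := p.le_of_mem_parts hi
  omega

/-- The partitions of `n + m` with parts in `insert m A` either avoid `m`, or arise from a
partition of `n` by adding a part `m`. -/
theorem partCount_insert_add {A : Finset ℕ} {m : ℕ} (hA : m ∉ A) (hm : 0 < m) (n : ℕ) :
    partCount (insert m A) (n + m) = partCount A (n + m) + partCount (insert m A) n := by
  unfold partCount
  rw [← Finset.card_filter_add_card_filter_not (fun p : Nat.Partition (n + m) => m ∉ p.parts)]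
  congr 1
  · congr 1
    ext p
    simp only [Finset.mem_filter, Finset.mem_univ, true_and, Finset.mem_insert]
    constructor
    · rintro ⟨h, hp⟩ i hi
      exact (h i hi).resolve_left (by rintro rfl; exact hp hi)
    · exact fun h => ⟨fun i hi => Or.inr (h i hi), fun hp => hA (h m hp)⟩
  · symm
    refine Finset.card_bij (fun p _ => ⟨m ::ₘ p.parts, ?_, ?_⟩) ?_ ?_ ?_
    · intro i hi
      rcases Multiset.mem_cons.1 hi with rfl | hi
      · exact hm
      · exact p.parts_pos hi
    · rw [Multiset.sum_cons, p.parts_sum, add_comm]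
    · intro p hp
      simp only [Finset.mem_filter, Finset.mem_univ, true_and, Finset.mem_insert] at hp
      simpa using hp
    · intro p _ q _ h
      ext1
      simpa using h
    · intro p hp
      simp only [Finset.mem_filter, Finset.mem_univ, true_and, not_not] at hp
      refine ⟨⟨p.parts.erase m, fun hi => p.parts_pos (Multiset.mem_of_mem_erase hi), ?_⟩, ?_, ?_⟩
      · have h := congrArg Multiset.sum (Multiset.cons_erase hp.2)
        rw [Multiset.sum_cons, p.parts_sum] at h
        omega
      · simp only [Finset.mem_filter, Finset.mem_univ, true_and]
        exact fun i hi => hp.1 i (Multiset.mem_of_mem_erase hi)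
      · ext1
        exact Multiset.cons_erase hp.2

theorem partCount_empty_zero : partCount ∅ 0 = 1 := by
  simp [partCount]

theorem partCount_empty_succ (n : ℕ) : partCount ∅ (n + 1) = 0 := by
  unfold partCount
  rw [Finset.card_eq_zero, Finset.filter_eq_empty_iff]
  intro p _ h
  have h0 : p.parts = 0 := Multiset.eq_zero_of_forall_notMem fun i hi => by simpa using h i hi
  simpa [h0] using p.parts_sum

theorem partCount_one (n : ℕ) : partCount {1} n = 1 := by
  rw [← insert_empty_eq]
  induction n with
  | zero => rw [partCount_insert_of_lt one_pos, partCount_empty_zero]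
  | succ n ih => rw [partCount_insert_add (by simp) one_pos, partCount_empty_succ, ih]

theorem partCount_one_two (n : ℕ) : partCount {1, 2} n = n / 2 + 1 := by
  rw [Finset.pair_comm]
  induction n using Nat.strong_induction_on with
  | _ n ih =>
    rcases lt_or_ge n 2 with h | h
    · rw [partCount_insert_of_lt h, partCount_one]
      omega
    · obtain ⟨k, rfl⟩ := Nat.exists_eq_add_of_le' h
      rw [partCount_insert_add (by simp) two_pos, partCount_one, ih k (by omega)]
      omega

theorem partCount_one_two_three_of_lt {n : ℕ} (h : n < 3) :
    partCount {1, 2, 3} n = n / 2 + 1 := by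
  rw [show ({1, 2, 3} : Finset ℕ) = insert 3 {1, 2} by decide, partCount_insert_of_lt h,
    partCount_one_two]

theorem partCount_one_two_three_add_three (n : ℕ) :
    partCount {1, 2, 3} (n + 3) = (n + 3) / 2 + 1 + partCount {1, 2, 3} n := by
  rw [show ({1, 2, 3} : Finset ℕ) = insert 3 {1, 2} by decide,
    partCount_insert_add (by simp) three_pos, partCount_one_two]

theorem partCount_one_two_three_add_six (n : ℕ) :
    partCount {1, 2, 3} (n + 6) = n + 6 + partCount {1, 2, 3} n := by
  have h₁ := partCount_one_two_three_add_three n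
  have h₂ := partCount_one_two_three_add_three (n + 3)
  simp only [add_assoc, Nat.reduceAdd] at h₂
  omega

/-- The values of `partCount {1, 2, 3}` along a residue class modulo `6`. -/
theorem partCount_one_two_three_six_mul_add (q r : ℕ) :
    partCount {1, 2, 3} (6 * q + r) = 3 * q ^ 2 + 3 * q + r * q + partCount {1, 2, 3} r := by
  induction q with
  | zero => simp
  | succ q ih =>
    rw [show 6 * (q + 1) + r = 6 * q + r + 6 by ring, partCount_one_two_three_add_six, ih]
    ring

theorem partCount_one_two_three_four_of_lt {n : ℕ} (h : n < 4) :
    partCount {1, 2, 3, 4} n = partCount {1, 2, 3} n := by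
  rw [show ({1, 2, 3, 4} : Finset ℕ) = insert 4 {1, 2, 3} by decide, partCount_insert_of_lt h]

theorem partCount_one_two_three_four_add_four (n : ℕ) :
    partCount {1, 2, 3, 4} (n + 4) = partCount {1, 2, 3} (n + 4) + partCount {1, 2, 3, 4} n := by
  rw [show ({1, 2, 3, 4} : Finset ℕ) = insert 4 {1, 2, 3} by decide,
    partCount_insert_add (by simp) four_pos]

theorem partCount_one_two_three_four_twelve_mul_add_eight (s : ℕ) :
    partCount {1, 2, 3, 4} (12 * s + 8) = 3 * (s + 1) ^ 2 * (4 * s + 5) := by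
  have p0 : partCount {1, 2, 3} 0 = 1 := partCount_one_two_three_of_lt (by norm_num)
  have p1 : partCount {1, 2, 3} 1 = 1 := partCount_one_two_three_of_lt (by norm_num)
  have p2 : partCount {1, 2, 3} 2 = 2 := partCount_one_two_three_of_lt (by norm_num)
  have p4 : partCount {1, 2, 3} 4 = 4 := by
    rw [partCount_one_two_three_add_three 1, p1]
  induction s with
  | zero =>
    have p8 := partCount_one_two_three_six_mul_add 1 2
    rw [p2] at p8
    rw [partCount_one_two_three_four_add_four, partCount_one_two_three_four_add_four 0,
      partCount_one_two_three_four_of_lt (by norm_num)]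
    norm_num [p0, p4] at p8 ⊢
    rw [p8]
  | succ s ih =>
    have h₁ := partCount_one_two_three_four_add_four (12 * s + 8)
    have h₂ := partCount_one_two_three_four_add_four (12 * s + 12)
    have h₃ := partCount_one_two_three_four_add_four (12 * s + 16)
    have e₁ := partCount_one_two_three_six_mul_add (2 * s + 2) 0
    have e₂ := partCount_one_two_three_six_mul_add (2 * s + 2) 4
    have e₃ := partCount_one_two_three_six_mul_add (2 * s + 3) 2
    rw [show 6 * (2 * s + 2) + 0 = 12 * s + 12 by ring] at e₁
    rw [show 6 * (2 * s + 2) + 4 = 12 * s + 16 by ring] at e₂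
    rw [show 6 * (2 * s + 3) + 2 = 12 * s + 20 by ring] at e₃
    simp only [add_assoc, Nat.reduceAdd] at h₁ h₂ h₃
    rw [show 12 * (s + 1) + 8 = 12 * s + 20 by ring, h₃, h₂, h₁, ih, e₁, e₂, e₃, p0, p2, p4]
    ring

theorem partCount_one_two_three_six_mul_add_three (q : ℕ) :
    partCount {1, 2, 3} (6 * q + 3) = 3 * (q + 1) ^ 2 := by
  rw [partCount_one_two_three_six_mul_add, partCount_one_two_three_add_three 0,
    partCount_one_two_three_of_lt (by norm_num)]
  ring

theorem stmt4 :
    {xy : ℕ × ℕ | 0 < xy.1 ∧ 0 < xy.2 ∧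
      partCount {1, 2, 3} xy.1 = partCount {1, 2, 3, 4} xy.2}.Infinite := by
  refine Set.infinite_of_injective_forall_mem
    (f := fun a : ℕ =>
      (6 * (2 * a ^ 3 + 9 * a ^ 2 + 13 * a + 5) + 3, 12 * (a ^ 2 + 3 * a + 1) + 8)) ?_ ?_
  · intro a b h
    have h' := (Prod.mk.inj h).2
    nlinarith
  · intro a
    refine ⟨by positivity, by positivity, ?_⟩
    rw [partCount_one_two_three_six_mul_add_three,
      partCount_one_two_three_four_twelve_mul_add_eight]
    ring
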